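/- Let S=(E,A,B,C,D) be an antistable system of order n with Gramians X_c, X_o and largest Hankel singular value σ₁, let γ ≥ σ₁, and suppose the pair (E_γ, A_γ) is regular. Then for every ω ∈ ℝ the matrix iωE_γ − A_γ is invertible and ‖G_S(iω) − G_γ(iω)‖₂ ≤ γ, where G_γ(iω) = C_γ(iωE_γ − A_γ)^{-1}B_γ + D; i.e. the stable system (E_γ, A_γ, B_γ, C_γ, D) is a γ-suboptimal RH∞-approximation of S. -/

import Mathlib

open Matrix

noncomputable section

/-- Entrywise complexification of a real matrix. -/
def cplx {ι κ : Type*} (M : Matrix ι κ ℝ) : Matrix ι κ ℂ :=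
  M.map fun x => (x : ℂ)

/-- The matrix pair (E, A) is regular: det(sE − A) ≠ 0 for some s ∈ ℂ. -/
def RegularPair {ι : Type*} [Fintype ι] [DecidableEq ι] (E A : Matrix ι ι ℝ) : Prop :=
  ∃ s : ℂ, (s • cplx E - cplx A).det ≠ 0

/-- (E, A) is stable: sE − A is invertible for every s with Re s ≥ 0. -/
def StablePair {ι : Type*} [Fintype ι] [DecidableEq ι] (E A : Matrix ι ι ℝ) : Prop :=
  ∀ s : ℂ, 0 ≤ s.re → IsUnit (s • cplx E - cplx A)

/-- (E, A) is antistable: E invertible and sE − A invertible for every s with Re s ≤ 0. -/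
def AntistablePair {ι : Type*} [Fintype ι] [DecidableEq ι] (E A : Matrix ι ι ℝ) : Prop :=
  IsUnit E ∧ ∀ s : ℂ, s.re ≤ 0 → IsUnit (s • cplx E - cplx A)

/-- Transfer function G(s) = C (sE − A)⁻¹ B + D of the system (E, A, B, C, D). -/
def transfer {ι κm κp : Type*} [Fintype ι] [DecidableEq ι]
    (E A : Matrix ι ι ℝ) (B : Matrix ι κm ℝ) (C : Matrix κp ι ℝ) (D : Matrix κp κm ℝ)
    (s : ℂ) : Matrix κp κm ℂ :=
  cplx C * (s • cplx E - cplx A)⁻¹ * cplx B + cplx D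

/-- Spectral norm (ℓ² operator norm) of a complex matrix. -/
def spec2 {κp κm : Type*} [Fintype κp] [Fintype κm] [DecidableEq κm]
    (M : Matrix κp κm ℂ) : ℝ :=
  ‖LinearMap.toContinuousLinearMap (Matrix.toEuclideanLin M)‖

/-- Squared Frobenius norm of a complex matrix. -/
def frobSq {κp κm : Type*} [Fintype κp] [Fintype κm] (M : Matrix κp κm ℂ) : ℝ :=
  ∑ i, ∑ j, ‖M i j‖ ^ 2

/-- `Xc`, `Xo` are controllability/observability Gramians of the system (E, A, B, C, ·). -/
def IsGramians {ι κm κp : Type*} [Fintype ι] [Fintype κm] [Fintype κp]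
    (E A : Matrix ι ι ℝ) (B : Matrix ι κm ℝ) (C : Matrix κp ι ℝ)
    (Xc Xo : Matrix ι ι ℝ) : Prop :=
  Xc.IsSymm ∧ Xo.IsSymm ∧
    A * Xc * Eᵀ + E * Xc * Aᵀ + B * Bᵀ = 0 ∧
    Aᵀ * Xo * E + Eᵀ * Xo * A + Cᵀ * C = 0

/-- σ₁ ≥ 0 is the largest Hankel singular value: σ₁² is the greatest eigenvalue of XcEᵀXoE. -/
def IsLargestHSV {ι : Type*} [Fintype ι] [DecidableEq ι]
    (E Xc Xo : Matrix ι ι ℝ) (σ1 : ℝ) : Prop :=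
  0 ≤ σ1 ∧ ((σ1 : ℂ) ^ 2) ∈ spectrum ℂ (cplx (Xc * Eᵀ * Xo * E)) ∧
    ∀ μ ∈ spectrum ℂ (cplx (Xc * Eᵀ * Xo * E)), μ.re ≤ σ1 ^ 2

/-- R_γ = XoEXcEᵀ − γ²I. -/
def Rg {ι : Type*} [Fintype ι] [DecidableEq ι] (E Xc Xo : Matrix ι ι ℝ) (γ : ℝ) :
    Matrix ι ι ℝ :=
  Xo * E * Xc * Eᵀ - γ ^ 2 • (1 : Matrix ι ι ℝ)

/-- E_γ = Eᵀ R_γ. -/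
def Eg {ι : Type*} [Fintype ι] [DecidableEq ι] (E Xc Xo : Matrix ι ι ℝ) (γ : ℝ) :
    Matrix ι ι ℝ :=
  Eᵀ * Rg E Xc Xo γ

/-- C_γ = C Xc Eᵀ. -/
def Cg {ι κp : Type*} [Fintype ι] (C : Matrix κp ι ℝ) (E Xc : Matrix ι ι ℝ) :
    Matrix κp ι ℝ :=
  C * Xc * Eᵀ

/-- A_γ = −Aᵀ R_γ − Cᵀ C_γ. -/
def Ag {ι κp : Type*} [Fintype ι] [Fintype κp] [DecidableEq ι]
    (E A : Matrix ι ι ℝ) (C : Matrix κp ι ℝ) (Xc Xo : Matrix ι ι ℝ) (γ : ℝ) :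
    Matrix ι ι ℝ :=
  -(Aᵀ * Rg E Xc Xo γ) - Cᵀ * Cg C E Xc

/-- B_γ = Eᵀ Xo B. -/
def Bg {ι κm : Type*} [Fintype ι] (E Xo : Matrix ι ι ℝ) (B : Matrix ι κm ℝ) :
    Matrix ι κm ℝ :=
  Eᵀ * Xo * B

/-- The point iω on the imaginary axis. -/
def iax (ω : ℝ) : ℂ := (ω : ℂ) * Complex.I

/-- Canonical equivalence Fin k ⊕ Fin d ≃ Fin n given k + d = n. -/
def finBlockEquiv {k d n : ℕ} (h : k + d = n) : Fin k ⊕ Fin d ≃ Fin n :=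
  finSumFinEquiv.trans (finCongr h)

end

noncomputable section

section Cplx

variable {ι κ l : Type*}

theorem cplx_mul [Fintype κ] (M : Matrix ι κ ℝ) (N : Matrix κ l ℝ) :
    cplx (M * N) = cplx M * cplx N :=
  Matrix.map_mul (f := Complex.ofRealHom)

theorem cplx_add (M N : Matrix ι κ ℝ) : cplx (M + N) = cplx M + cplx N := by
  ext; simp [cplx]

theorem cplx_sub (M N : Matrix ι κ ℝ) : cplx (M - N) = cplx M - cplx N := by
  ext; simp [cplx]

theorem cplx_neg (M : Matrix ι κ ℝ) : cplx (-M) = -cplx M := by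
  ext; simp [cplx]

theorem cplx_zero : cplx (0 : Matrix ι κ ℝ) = 0 := by
  ext; simp [cplx]

theorem cplx_one [DecidableEq ι] : cplx (1 : Matrix ι ι ℝ) = 1 := by
  ext i j; by_cases h : i = j <;> simp [cplx, h, Matrix.one_apply]

theorem cplx_smul (r : ℝ) (M : Matrix ι κ ℝ) : cplx (r • M) = (r : ℂ) • cplx M := by
  ext; simp [cplx]

theorem cplx_transpose (M : Matrix ι κ ℝ) : cplx Mᵀ = (cplx M)ᴴ := by
  ext; simp [cplx]

theorem conjTranspose_cplx_of_isSymm {X : Matrix ι ι ℝ} (hX : X.IsSymm) :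
    (cplx X)ᴴ = cplx X := by
  rw [← cplx_transpose, hX.eq]

theorem conjTranspose_pencil_iax (E A : Matrix ι ι ℝ) (ω : ℝ) :
    (iax ω • cplx E - cplx A)ᴴ = -(iax ω • (cplx E)ᴴ + (cplx A)ᴴ) := by
  have : star (iax ω) = -iax ω := by simp [iax]
  rw [Matrix.conjTranspose_sub, Matrix.conjTranspose_smul, this, neg_smul]
  abel

end Cplx

theorem star_dotProduct_conjTranspose_mul_self_mulVec {ι κ : Type*} [Fintype ι] [Fintype κ]
    (L : Matrix ι κ ℂ) (v : κ → ℂ) :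
    star v ⬝ᵥ ((Lᴴ * L) *ᵥ v) = ((∑ i, ‖(L *ᵥ v) i‖ ^ 2 : ℝ) : ℂ) := by
  rw [← Matrix.mulVec_mulVec, Matrix.dotProduct_mulVec, ← Matrix.star_mulVec]
  simp [dotProduct, Complex.conj_mul']

/-- If `MᴴM + γ²KᴴK = γ²I` then the spectral norm of `M` is at most `γ`. -/
theorem spec2_le_of_conjTranspose_mul_self_add {κp κm κq : Type*} [Fintype κp] [Fintype κm]
    [Fintype κq] [DecidableEq κm] (M : Matrix κp κm ℂ) (K : Matrix κq κm ℂ) (γ : ℝ) (hγ : 0 ≤ γ)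
    (h : Mᴴ * M + ((γ : ℂ) ^ 2) • (Kᴴ * K) = ((γ : ℂ) ^ 2) • 1) : spec2 M ≤ γ := by
  refine ContinuousLinearMap.opNorm_le_bound _ hγ fun x => ?_
  refine le_of_sq_le_sq ?_ (by positivity)
  have h1 := congrArg (fun L => star (WithLp.ofLp x) ⬝ᵥ (L *ᵥ (WithLp.ofLp x))) h
  simp only [Matrix.add_mulVec, Matrix.smul_mulVec, dotProduct_add, dotProduct_smul,
    Matrix.one_mulVec, star_dotProduct_conjTranspose_mul_self_mulVec] at h1
  have h2 : star (WithLp.ofLp x) ⬝ᵥ (WithLp.ofLp x) = ((∑ i, ‖x i‖ ^ 2 : ℝ) : ℂ) := by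
    simp [dotProduct, Complex.conj_mul']
  rw [h2] at h1
  simp only [smul_eq_mul] at h1
  norm_cast at h1
  rw [mul_pow, EuclideanSpace.norm_sq_eq, EuclideanSpace.norm_sq_eq]
  have h3 : 0 ≤ γ ^ 2 * ∑ i, ‖(K *ᵥ (WithLp.ofLp x)) i‖ ^ 2 := by positivity
  have h4 : ∀ i, (LinearMap.toContinuousLinearMap (Matrix.toEuclideanLin M) x) i
      = (M *ᵥ (WithLp.ofLp x)) i := fun i => rfl
  simp only [h4]
  linarith

section Pencil

variable {ι κm κp l : Type*} [Fintype ι] [Fintype κm] [Fintype κp]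
  {P e w o : Matrix ι ι ℂ} {b : Matrix ι κm ℂ} {c : Matrix κp ι ℂ} {g : ℂ}

theorem output_conjTranspose_mul_self (hw : wᴴ = w) (ho : oᴴ = o) (hg : star g = g)
    (hc : P * w * eᴴ + e * w * Pᴴ = b * bᴴ) (hob : Pᴴ * o * e + eᴴ * o * P = cᴴ * c)
    {Y Z U : Matrix ι l ℂ} (hY : (eᴴ * o * P * w * eᴴ + g • Pᴴ) * Y = eᴴ * o * U)
    (hZ : P * Z = U - P * w * eᴴ * Y) :
    (c * Z)ᴴ * (c * Z) = g • (Uᴴ * Y + Yᴴ * U - (bᴴ * Y)ᴴ * (bᴴ * Y)) := by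
  have h1 : eᴴ * o * (P * Z) = g • (Pᴴ * Y) := by
    rw [hZ, Matrix.mul_sub, ← hY, Matrix.add_mul, Matrix.smul_mul]
    simp only [Matrix.mul_assoc]
    abel
  have h2 : (P * Z)ᴴ * o * e = g • (Yᴴ * P) := by
    have := congrArg conjTranspose h1
    simpa [Matrix.conjTranspose_mul, ho, hg, Matrix.mul_assoc] using this
  have h3 : (c * Z)ᴴ * (c * Z) = (P * Z)ᴴ * o * e * Z + Zᴴ * (eᴴ * o * (P * Z)) := by
    have : (c * Z)ᴴ * (c * Z) = Zᴴ * (cᴴ * c) * Z := by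
      simp only [Matrix.conjTranspose_mul, Matrix.mul_assoc]
    rw [this, ← hob]
    simp only [Matrix.conjTranspose_mul, Matrix.mul_assoc, Matrix.mul_add, Matrix.add_mul]
  have h4 : Zᴴ * Pᴴ = Uᴴ - Yᴴ * e * w * Pᴴ := by
    have := congrArg conjTranspose hZ
    simpa [Matrix.conjTranspose_mul, hw, Matrix.mul_assoc] using this
  have h5 : (bᴴ * Y)ᴴ * (bᴴ * Y) = Yᴴ * (b * bᴴ) * Y := by
    simp only [Matrix.conjTranspose_mul, Matrix.mul_assoc, Matrix.conjTranspose_conjTranspose]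
  rw [h3, h2, h1, h5, ← hc, Matrix.smul_mul, Matrix.mul_smul, ← smul_add, ← Matrix.mul_assoc Zᴴ,
    h4, Matrix.mul_assoc Yᴴ, hZ]
  congr 1
  simp only [Matrix.mul_assoc, Matrix.mul_add, Matrix.add_mul, Matrix.mul_sub, Matrix.sub_mul]
  abel

open scoped ComplexOrder in
theorem kernel_of_pencil [Fintype l] [DecidableEq ι] (hw : wᴴ = w) (ho : oᴴ = o) {γ : ℝ}
    (hP : IsUnit P)
    (hc : P * w * eᴴ + e * w * Pᴴ = b * bᴴ) (hob : Pᴴ * o * e + eᴴ * o * P = cᴴ * c)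
    {Y : Matrix ι l ℂ} (hY : (eᴴ * o * P * w * eᴴ + ((γ : ℂ) ^ 2) • Pᴴ) * Y = 0) :
    c * w * eᴴ * Y = 0 ∧ (o * e * w * eᴴ - ((γ : ℂ) ^ 2) • 1) * Y = 0 := by
  have hout := output_conjTranspose_mul_self (g := (γ : ℂ) ^ 2) (Y := Y) (U := 0)
    (Z := -(w * eᴴ * Y)) hw ho (by simp) hc hob (by simpa using hY)
    (by simp [Matrix.mul_assoc])
  have hcz : c * (w * eᴴ * Y) = 0 := by
    have hps1 := Matrix.posSemidef_conjTranspose_mul_self (c * -(w * eᴴ * Y))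
    have hps2 := Matrix.posSemidef_conjTranspose_mul_self (bᴴ * Y)
    have t1 := hps1.trace_nonneg
    have t2 := hps2.trace_nonneg
    have t3 := congrArg trace hout
    have hg0 : (0 : ℂ) ≤ (γ : ℂ) ^ 2 := by
      exact_mod_cast sq_nonneg γ
    simp only [Matrix.conjTranspose_zero, Matrix.zero_mul, Matrix.mul_zero, add_zero, zero_sub,
      smul_neg, Matrix.trace_neg, Matrix.trace_smul, smul_eq_mul] at t3
    have t4 : ((c * -(w * eᴴ * Y))ᴴ * (c * -(w * eᴴ * Y))).trace = 0 := by
      refine le_antisymm ?_ t1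
      rw [t3]
      exact neg_nonpos.mpr (mul_nonneg hg0 t2)
    have := Matrix.trace_conjTranspose_mul_self_eq_zero_iff.mp t4
    simpa using this
  refine ⟨by simpa only [Matrix.mul_assoc] using hcz, ?_⟩
  have h1 : (Pᴴ * o * e + eᴴ * o * P) * (w * eᴴ * Y) = 0 := by
    rw [hob, Matrix.mul_assoc, hcz, Matrix.mul_zero]
  have hPH : IsUnit Pᴴ := by simpa using hP.star
  have h2 : Pᴴ * ((o * e * w * eᴴ - ((γ : ℂ) ^ 2) • 1) * Y) = 0 := by
    have : Pᴴ * ((o * e * w * eᴴ - ((γ : ℂ) ^ 2) • 1) * Y)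
        = (Pᴴ * o * e + eᴴ * o * P) * (w * eᴴ * Y)
          - (eᴴ * o * P * w * eᴴ + ((γ : ℂ) ^ 2) • Pᴴ) * Y := by
      simp only [Matrix.mul_assoc, Matrix.mul_sub, Matrix.add_mul, Matrix.sub_mul,
        Matrix.smul_mul, Matrix.mul_smul, Matrix.one_mul]
      abel
    rw [this, h1, hY, sub_zero]
  have := congrArg (Pᴴ⁻¹ * ·) h2
  simpa [← Matrix.mul_assoc, Matrix.nonsing_inv_mul _ ((Matrix.isUnit_iff_isUnit_det _).mp hPH)]
    using this

end Pencil

section Approximant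

variable {ι κm κp : Type*} [Fintype ι] [Fintype κm] [Fintype κp]
  {E A Xc Xo : Matrix ι ι ℝ} {B : Matrix ι κm ℝ} {C : Matrix κp ι ℝ}

theorem approximant_pencil_eq [DecidableEq ι] (γ : ℝ) (s : ℂ) :
    s • cplx (Eg E Xc Xo γ) - cplx (Ag E A C Xc Xo γ) =
      (s • (cplx E)ᴴ + (cplx A)ᴴ) *
          (cplx Xo * cplx E * cplx Xc * (cplx E)ᴴ - ((γ : ℂ) ^ 2) • 1)
        + (cplx C)ᴴ * (cplx C * cplx Xc * (cplx E)ᴴ) := by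
  simp only [Eg, Ag, Rg, Cg, cplx_mul, cplx_sub, cplx_neg, cplx_smul, cplx_one, cplx_transpose,
    Complex.ofReal_pow, Matrix.add_mul, Matrix.smul_mul]
  abel

theorem approximant_pencil_eq_of_isGramians [DecidableEq ι]
    (hX : IsGramians E A B C Xc Xo) (γ : ℝ) (s : ℂ) :
    s • cplx (Eg E Xc Xo γ) - cplx (Ag E A C Xc Xo γ) =
      (cplx E)ᴴ * cplx Xo * (s • cplx E - cplx A) * cplx Xc * (cplx E)ᴴ
        + ((γ : ℂ) ^ 2) • (-(s • (cplx E)ᴴ + (cplx A)ᴴ)) := by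
  obtain ⟨-, -, -, ho⟩ := hX
  replace ho := congrArg cplx ho
  simp only [cplx_add, cplx_mul, cplx_transpose, cplx_zero] at ho
  rw [approximant_pencil_eq]
  have h : (cplx C)ᴴ * (cplx C * cplx Xc * (cplx E)ᴴ)
      = -((cplx A)ᴴ * cplx Xo * cplx E + (cplx E)ᴴ * cplx Xo * cplx A)
        * (cplx Xc * (cplx E)ᴴ) := by
    rw [← eq_neg_of_add_eq_zero_right ho]
    simp only [Matrix.mul_assoc]
  rw [h]
  simp only [Matrix.mul_assoc, Matrix.mul_sub, Matrix.add_mul, Matrix.sub_mul, Matrix.neg_mul,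
    Matrix.smul_mul, Matrix.mul_smul, Matrix.mul_one, smul_neg, smul_add]
  abel

theorem controllability_pencil_iax (hX : IsGramians E A B C Xc Xo) (ω : ℝ) :
    (iax ω • cplx E - cplx A) * cplx Xc * (cplx E)ᴴ
      + cplx E * cplx Xc * (iax ω • cplx E - cplx A)ᴴ = cplx B * (cplx B)ᴴ := by
  have h := congrArg cplx hX.2.2.1
  simp only [cplx_add, cplx_mul, cplx_transpose, cplx_zero] at h
  rw [eq_neg_of_add_eq_zero_right h, conjTranspose_pencil_iax]
  simp only [Matrix.mul_assoc, Matrix.sub_mul, Matrix.mul_add, Matrix.mul_neg, Matrix.smul_mul,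
    Matrix.mul_smul]
  abel

theorem observability_pencil_iax (hX : IsGramians E A B C Xc Xo) (ω : ℝ) :
    (iax ω • cplx E - cplx A)ᴴ * cplx Xo * cplx E
      + (cplx E)ᴴ * cplx Xo * (iax ω • cplx E - cplx A) = (cplx C)ᴴ * cplx C := by
  have h := congrArg cplx hX.2.2.2
  simp only [cplx_add, cplx_mul, cplx_transpose, cplx_zero] at h
  rw [eq_neg_of_add_eq_zero_right h, conjTranspose_pencil_iax]
  simp only [Matrix.mul_assoc, Matrix.add_mul, Matrix.mul_sub, Matrix.neg_mul, Matrix.smul_mul,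
    Matrix.mul_smul]
  abel

theorem isUnit_approximant_pencil_iax [DecidableEq ι] (hX : IsGramians E A B C Xc Xo) {γ : ℝ}
    (hreg : RegularPair (Eg E Xc Xo γ) (Ag E A C Xc Xo γ)) {ω : ℝ}
    (hP : IsUnit (iax ω • cplx E - cplx A)) :
    IsUnit (iax ω • cplx (Eg E Xc Xo γ) - cplx (Ag E A C Xc Xo γ)) := by
  rw [Matrix.isUnit_iff_isUnit_det, isUnit_iff_ne_zero]
  intro hdet
  obtain ⟨v, hv, hNv⟩ := Matrix.exists_mulVec_eq_zero_iff.mpr hdet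
  obtain ⟨s, hs⟩ := hreg
  refine hs (Matrix.exists_mulVec_eq_zero_iff.mp ⟨v, hv, ?_⟩)
  have hY : (iax ω • cplx (Eg E Xc Xo γ) - cplx (Ag E A C Xc Xo γ)) * replicateCol Unit v = 0 := by
    rw [← Matrix.replicateCol_mulVec, hNv, Matrix.replicateCol_zero]
  rw [approximant_pencil_eq_of_isGramians hX, ← conjTranspose_pencil_iax] at hY
  obtain ⟨h1, h2⟩ := kernel_of_pencil (conjTranspose_cplx_of_isSymm hX.1)
    (conjTranspose_cplx_of_isSymm hX.2.1) hP (controllability_pencil_iax hX ω)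
    (observability_pencil_iax hX ω) hY
  apply Matrix.replicateCol_injective (ι := Unit)
  rw [Matrix.replicateCol_mulVec, Matrix.replicateCol_zero, approximant_pencil_eq, Matrix.add_mul,
    Matrix.mul_assoc, h2, Matrix.mul_assoc, h1, Matrix.mul_zero, Matrix.mul_zero, add_zero]

theorem spec2_transfer_sub_approximant_le [DecidableEq ι] [DecidableEq κm] (D : Matrix κp κm ℝ)
    (hX : IsGramians E A B C Xc Xo) {γ : ℝ} (hγ : 0 ≤ γ) {ω : ℝ}
    (hP : IsUnit (iax ω • cplx E - cplx A))
    (hN : IsUnit (iax ω • cplx (Eg E Xc Xo γ) - cplx (Ag E A C Xc Xo γ))) :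
    spec2 (transfer E A B C D (iax ω) -
      transfer (Eg E Xc Xo γ) (Ag E A C Xc Xo γ) (Bg E Xo B) (Cg C E Xc) D (iax ω)) ≤ γ := by
  rw [Matrix.isUnit_iff_isUnit_det] at hP hN
  set Y : Matrix ι κm ℂ := (iax ω • cplx (Eg E Xc Xo γ) - cplx (Ag E A C Xc Xo γ))⁻¹
    * cplx (Bg E Xo B) with hYdef
  set Z : Matrix ι κm ℂ := (iax ω • cplx E - cplx A)⁻¹ * cplx B - cplx Xc * (cplx E)ᴴ * Y
    with hZdef
  have hY : (iax ω • cplx (Eg E Xc Xo γ) - cplx (Ag E A C Xc Xo γ)) * Y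
      = (cplx E)ᴴ * cplx Xo * cplx B := by
    rw [hYdef, ← Matrix.mul_assoc, Matrix.mul_nonsing_inv _ hN, Matrix.one_mul]
    simp only [Bg, cplx_mul, cplx_transpose]
  rw [approximant_pencil_eq_of_isGramians hX, ← conjTranspose_pencil_iax] at hY
  have hZ : (iax ω • cplx E - cplx A) * Z
      = cplx B - (iax ω • cplx E - cplx A) * cplx Xc * (cplx E)ᴴ * Y := by
    rw [hZdef, Matrix.mul_sub, ← Matrix.mul_assoc, Matrix.mul_nonsing_inv _ hP, Matrix.one_mul]
    simp only [Matrix.mul_assoc]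
  have herr : transfer E A B C D (iax ω) -
      transfer (Eg E Xc Xo γ) (Ag E A C Xc Xo γ) (Bg E Xo B) (Cg C E Xc) D (iax ω)
      = cplx C * Z := by
    rw [hZdef, hYdef, transfer, transfer, add_sub_add_right_eq_sub]
    simp only [Cg, cplx_mul, cplx_transpose, Matrix.mul_sub, Matrix.mul_assoc]
  rw [herr]
  refine spec2_le_of_conjTranspose_mul_self_add _ (1 - (cplx B)ᴴ * Y) γ hγ ?_
  rw [output_conjTranspose_mul_self (conjTranspose_cplx_of_isSymm hX.1)
    (conjTranspose_cplx_of_isSymm hX.2.1) (by simp) (controllability_pencil_iax hX ω)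
    (observability_pencil_iax hX ω) hY hZ, ← smul_add]
  congr 1
  simp only [Matrix.conjTranspose_sub, Matrix.conjTranspose_one, Matrix.conjTranspose_mul,
    Matrix.conjTranspose_conjTranspose, Matrix.sub_mul, Matrix.mul_sub, Matrix.one_mul,
    Matrix.mul_one]
  abel

end Approximant

theorem stmt10 {n m p : ℕ}
    (E A : Matrix (Fin n) (Fin n) ℝ) (B : Matrix (Fin n) (Fin m) ℝ)
    (C : Matrix (Fin p) (Fin n) ℝ) (D : Matrix (Fin p) (Fin m) ℝ)
    (hanti : AntistablePair E A)
    (Xc Xo : Matrix (Fin n) (Fin n) ℝ) (hX : IsGramians E A B C Xc Xo)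
    (σ1 : ℝ) (hσ : IsLargestHSV E Xc Xo σ1)
    (γ : ℝ) (hγ : σ1 ≤ γ)
    (hregγ : RegularPair (Eg E Xc Xo γ) (Ag E A C Xc Xo γ)) :
    ∀ ω : ℝ, IsUnit (iax ω • cplx (Eg E Xc Xo γ) - cplx (Ag E A C Xc Xo γ)) ∧
      spec2 (transfer E A B C D (iax ω) -
        transfer (Eg E Xc Xo γ) (Ag E A C Xc Xo γ) (Bg E Xo B) (Cg C E Xc) D
          (iax ω)) ≤ γ := by
  intro ω
  have hP : IsUnit (iax ω • cplx E - cplx A) := hanti.2 _ (by simp [iax])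
  have hN := isUnit_approximant_pencil_iax hX hregγ hP
  exact ⟨hN, spec2_transfer_sub_approximant_le D hX (hσ.1.trans hγ) hP hN⟩

end
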